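/- For any real α > 1 there exists a constant C_α depending only on α such that, for every sequence (u_k)_{k∈ℕ} of nonnegative real numbers and every positive integer n, Σ_{k ≥ 2n} u_k ≤ C_α Σ_{k ≥ n+1} k^{−1/α} (Σ_{ℓ ≥ k} u_ℓ^α)^{1/α}. -/

import Mathlib

open scoped ENNReal

theorem ENNReal.sum_le_card_rpow_mul_sum_rpow {ι : Type*} (s : Finset ι) (f : ι → ℝ≥0∞)
    {p : ℝ} (hp : 1 ≤ p) :
    ∑ i ∈ s, f i ≤ (s.card : ℝ≥0∞) ^ (1 - 1 / p) * (∑ i ∈ s, f i ^ p) ^ (1 / p) := by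
  have hp0 : 0 < p := by linarith
  have h := ENNReal.rpow_le_rpow (ENNReal.rpow_sum_le_const_mul_sum_rpow s f hp)
    (by positivity : 0 ≤ 1 / p)
  rw [← ENNReal.rpow_mul, mul_one_div_cancel hp0.ne', ENNReal.rpow_one,
    ENNReal.mul_rpow_of_nonneg _ _ (by positivity), ← ENNReal.rpow_mul] at h
  rwa [show (p - 1) * (1 / p) = 1 - 1 / p by field_simp] at h

/-- The `ℓ^p` norm of the tail of `v` starting at `k`. -/
noncomputable def tailNorm (p : ℝ) (v : ℕ → ℝ≥0∞) (k : ℕ) : ℝ≥0∞ :=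
  (∑' l : ℕ, v (k + l) ^ p) ^ (1 / p)

theorem ENNReal.sum_Ico_le_tsum_add (f : ℕ → ℝ≥0∞) (a b : ℕ) :
    ∑ i ∈ Finset.Ico a b, f i ≤ ∑' l : ℕ, f (a + l) := by
  rw [Finset.sum_Ico_eq_sum_range]
  exact ENNReal.sum_le_tsum _

theorem tailNorm_antitone {p : ℝ} (hp : 0 < p) (v : ℕ → ℝ≥0∞) : Antitone (tailNorm p v) := by
  intro k m hkm
  obtain ⟨d, rfl⟩ := Nat.exists_eq_add_of_le hkm
  refine ENNReal.rpow_le_rpow ?_ (by positivity)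
  simp_rw [add_assoc]
  exact ENNReal.tsum_comp_le_tsum_of_injective (add_right_injective d) fun l => v (k + l) ^ p

theorem sum_Ico_two_mul_le {p : ℝ} (hp : 1 ≤ p) (v : ℕ → ℝ≥0∞) {m : ℕ} (hm : 1 ≤ m) :
    ∑ i ∈ Finset.Ico (2 * m) (2 * (2 * m)), v i ≤
      2 * ∑ k ∈ Finset.Ico (m + 1) (2 * m + 1), (k : ℝ≥0∞) ^ (-(1 / p)) * tailNorm p v k := by
  have hp0 : 0 < p := by linarith
  have hq : ((2 * m : ℕ) : ℝ≥0∞) ≠ 0 := by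
    exact_mod_cast (by omega : 2 * m ≠ 0)
  calc
    _ ≤ ((2 * m : ℕ) : ℝ≥0∞) ^ (1 - 1 / p) * tailNorm p v (2 * m) := by
      refine (ENNReal.sum_le_card_rpow_mul_sum_rpow _ v hp).trans ?_
      rw [Nat.card_Ico, show 2 * (2 * m) - 2 * m = 2 * m by omega]
      gcongr
      exact ENNReal.rpow_le_rpow (ENNReal.sum_Ico_le_tsum_add (fun i => v i ^ p) _ _) (by positivity)
    _ = 2 * ∑ _k ∈ Finset.Ico (m + 1) (2 * m + 1),
        ((2 * m : ℕ) : ℝ≥0∞) ^ (-(1 / p)) * tailNorm p v (2 * m) := by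
      rw [Finset.sum_const, Nat.card_Ico, show 2 * m + 1 - (m + 1) = m by omega, nsmul_eq_mul,
        sub_eq_add_neg, ENNReal.rpow_add _ _ hq (ENNReal.natCast_ne_top _), ENNReal.rpow_one]
      push_cast
      ring
    _ ≤ _ := by
      gcongr 2 * ?_
      refine Finset.sum_le_sum fun k hk => ?_
      have hk' : k ≤ 2 * m := by
        have := Finset.mem_Ico.1 hk
        omega
      refine mul_le_mul' ?_ (tailNorm_antitone hp0 v hk')
      rw [ENNReal.rpow_neg, ENNReal.rpow_neg, ENNReal.inv_le_inv]
      exact ENNReal.rpow_le_rpow (by exact_mod_cast hk') (by positivity)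

theorem sum_Ico_dyadic_le {p : ℝ} (hp : 1 ≤ p) (v : ℕ → ℝ≥0∞) {n : ℕ} (hn : 1 ≤ n) (j : ℕ) :
    ∑ i ∈ Finset.Ico (2 * n) (2 * (2 ^ j * n)), v i ≤
      2 * ∑ k ∈ Finset.Ico (n + 1) (2 ^ j * n + 1),
        (k : ℝ≥0∞) ^ (-(1 / p)) * tailNorm p v k := by
  induction j with
  | zero => simp
  | succ j ih =>
    have hm : n ≤ 2 ^ j * n := Nat.le_mul_of_pos_left n (by positivity)
    rw [show 2 ^ (j + 1) * n = 2 * (2 ^ j * n) by ring]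
    generalize 2 ^ j * n = m at *
    rw [← Finset.sum_Ico_consecutive v (by omega : 2 * n ≤ 2 * m) (by omega),
      ← Finset.sum_Ico_consecutive _ (by omega : n + 1 ≤ m + 1) (by omega : m + 1 ≤ 2 * m + 1),
      mul_add]
    exact add_le_add ih (sum_Ico_two_mul_le hp v (by omega))

theorem tsum_le_two_mul_tsum_tailNorm {p : ℝ} (hp : 1 ≤ p) (v : ℕ → ℝ≥0∞) {n : ℕ}
    (hn : 1 ≤ n) :
    ∑' k : ℕ, v (2 * n + k) ≤
      2 * ∑' k : ℕ, ((n + 1 + k : ℕ) : ℝ≥0∞) ^ (-(1 / p)) * tailNorm p v (n + 1 + k) := by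
  rw [ENNReal.tsum_eq_iSup_nat]
  refine iSup_le fun N => ?_
  have hN : 2 * n + N ≤ 2 * (2 ^ (N + 1) * n) := by
    have : N + 1 < 2 ^ (N + 1) := Nat.lt_two_pow_self
    nlinarith
  calc
    _ = ∑ i ∈ Finset.Ico (2 * n) (2 * n + N), v i := by
      rw [Finset.sum_Ico_eq_sum_range, Nat.add_sub_cancel_left]
    _ ≤ ∑ i ∈ Finset.Ico (2 * n) (2 * (2 ^ (N + 1) * n)), v i :=
      Finset.sum_le_sum_of_subset (Finset.Ico_subset_Ico_right hN)
    _ ≤ _ := sum_Ico_dyadic_le hp v hn (N + 1)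
    _ ≤ _ := by
      gcongr
      exact ENNReal.sum_Ico_le_tsum_add (fun k => (k : ℝ≥0∞) ^ (-(1 / p)) * tailNorm p v k) _ _


/-- The elementary series inequality \eqref{factseries}: for any `α > 1` there is a
constant `C_α` such that for every sequence of nonnegative numbers `(u_k)` and every
positive integer `n`,
`∑_{k ≥ 2n} u_k ≤ C_α ∑_{k ≥ n+1} k^{-1/α} (∑_{ℓ ≥ k} u_ℓ^α)^{1/α}`
(the sums being interpreted in the extended reals). -/
theorem stmt19 (α : ℝ) (hα : 1 < α) :
    ∃ C : ℝ≥0∞, 0 < C ∧ C ≠ ⊤ ∧ ∀ (u : ℕ → ℝ), (∀ k, 0 ≤ u k) → ∀ n : ℕ, 1 ≤ n →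
      ∑' k : ℕ, ENNReal.ofReal (u (2 * n + k)) ≤
        C * ∑' k : ℕ,
          (((n : ℝ≥0∞) + 1 + k) ^ (-(1 / α)) *
            (∑' ℓ : ℕ, ENNReal.ofReal (u (n + 1 + k + ℓ)) ^ α) ^ (1 / α)) := by
  refine ⟨2, by norm_num, by norm_num, fun u _ n hn => ?_⟩
  simpa [tailNorm] using tsum_le_two_mul_tsum_tailNorm hα.le (fun k => ENNReal.ofReal (u k)) hn
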